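/- arXiv:2604.07275 — 2 statements merged into one kernel-verified Lean document; each statement's English description precedes it below -/
import Mathlib

section
/- For α>0, β>α, γ≥1 and any real x, the three-parameter Mittag-Leffler function satisfies the recurrence x·E^γ_{α,β}(x) = E^γ_{α,β−α}(x) − E^{γ−1}_{α,β−α}(x). -/
noncomputable def ml3 (α β γ x : ℝ) : ℝ :=
  if γ = 0 then 1 / Real.Gamma β
  else (1 / Real.Gamma γ) *
    ∑' j : ℕ, Real.Gamma ((j : ℝ) + γ) * x ^ j / ((j.factorial : ℝ) * Real.Gamma ((j : ℝ) * α + β))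

lemma gamma_ratio_lower (α y : ℝ) (hα : 0 < α) (hy : 1 < y) :
    (y - 1) ^ α * Real.Gamma y ≤ Real.Gamma (y + α) := by
  have h := Real.convexOn_log_Gamma.slope_mono_adjacent (x := y - 1) (y := y) (z := y + α)
    (by simp; linarith) (by simp; linarith) (by linarith) (by linarith)
  simp only [Function.comp] at h
  have h1 : Real.Gamma y = (y - 1) * Real.Gamma (y - 1) := by
    have := Real.Gamma_add_one (s := y - 1) (by linarith)
    simpa using this
  have p1 : 0 < y - 1 := by linarith
  have g1 : 0 < Real.Gamma (y - 1) := Real.Gamma_pos_of_pos p1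
  have g2 : 0 < Real.Gamma y := Real.Gamma_pos_of_pos (by linarith)
  have g3 : 0 < Real.Gamma (y + α) := Real.Gamma_pos_of_pos (by linarith)
  have h2 : Real.log (Real.Gamma y) - Real.log (Real.Gamma (y - 1)) = Real.log (y - 1) := by
    rw [h1, Real.log_mul p1.ne' g1.ne']; ring
  rw [h2, show y - (y - 1) = 1 by ring, show y + α - y = α by ring, div_one, le_div_iff₀ hα] at h
  have q : 0 < (y - 1) ^ α := Real.rpow_pos_of_pos p1 α
  rw [← Real.log_le_log_iff (by positivity) g3, Real.log_mul q.ne' g2.ne', Real.log_rpow p1]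
  linarith

lemma ml3_summable (α b γ x : ℝ) (hα : 0 < α) (hb : 0 < b) (hγ : 0 < γ) :
    Summable fun j : ℕ => Real.Gamma ((j : ℝ) + γ) * x ^ j /
      ((j.factorial : ℝ) * Real.Gamma ((j : ℝ) * α + b)) := by
  apply summable_of_ratio_norm_eventually_le (r := 1 / 2) (by norm_num)
  have t1 : Filter.Tendsto (fun j : ℕ => (j : ℝ) * α + b - 1) Filter.atTop Filter.atTop := by
    have : Filter.Tendsto (fun j : ℕ => (j : ℝ) * α) Filter.atTop Filter.atTop :=
      tendsto_natCast_atTop_atTop.atTop_mul_const hα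
    simpa [add_sub_assoc] using Filter.tendsto_atTop_add_const_right _ (b - 1) this
  have t2 := (tendsto_rpow_atTop hα).comp t1
  filter_upwards [t1.eventually_gt_atTop 0, t2.eventually_ge_atTop (2 * (γ + 1) * |x|)]
    with j h1 h2
  simp only [Function.comp] at h2
  have hj : (0 : ℝ) ≤ j := Nat.cast_nonneg j
  have hr := gamma_ratio_lower α ((j : ℝ) * α + b) hα (by linarith)
  have g0 : 0 < Real.Gamma ((j : ℝ) + γ) := Real.Gamma_pos_of_pos (by linarith)
  have g2 : 0 < Real.Gamma ((j : ℝ) * α + b) := Real.Gamma_pos_of_pos (by linarith)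
  have g3 : 0 < Real.Gamma ((j : ℝ) * α + b + α) := Real.Gamma_pos_of_pos (by linarith)
  have e1 : Real.Gamma (((j + 1 : ℕ) : ℝ) + γ) = (j + γ) * Real.Gamma (j + γ) := by
    rw [← Real.Gamma_add_one (by linarith)]; push_cast; ring_nf
  have e2 : ((j + 1 : ℕ) : ℝ) * α + b = (j : ℝ) * α + b + α := by push_cast; ring
  have f0 : (0 : ℝ) < j.factorial := by exact_mod_cast j.factorial_pos
  rw [e1, e2, Nat.factorial_succ]
  push_cast
  simp only [norm_div, norm_mul, norm_pow, Real.norm_eq_abs, abs_of_pos g0, abs_of_pos g2,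
    abs_of_pos g3, abs_of_pos f0, abs_of_pos (show (0 : ℝ) < j + 1 by linarith),
    abs_of_pos (show (0 : ℝ) < j + γ by linarith)]
  have key : 2 * (γ + 1) * |x| * Real.Gamma ((j : ℝ) * α + b) ≤
      Real.Gamma ((j : ℝ) * α + b + α) :=
    le_trans (mul_le_mul_of_nonneg_right h2 g2.le) hr
  have key2 : (j + γ) * |x| * Real.Gamma ((j : ℝ) * α + b) * 2 ≤
      (j + 1) * Real.Gamma ((j : ℝ) * α + b + α) := by
    have a : (j : ℝ) + γ ≤ (j + 1) * (γ + 1) := by nlinarith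
    have c : 0 ≤ |x| * Real.Gamma ((j : ℝ) * α + b) * 2 := by positivity
    nlinarith [mul_le_mul_of_nonneg_right a c,
      mul_le_mul_of_nonneg_left key (show (0 : ℝ) ≤ j + 1 by linarith)]
  rw [← mul_div_assoc, div_le_div_iff₀ (by positivity) (by positivity)]
  have d : 0 ≤ Real.Gamma ((j : ℝ) + γ) * |x| ^ j * j.factorial / 2 := by positivity
  calc _ = (Real.Gamma ((j : ℝ) + γ) * |x| ^ j * j.factorial / 2) *
        ((j + γ) * |x| * Real.Gamma ((j : ℝ) * α + b) * 2) := by ring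
    _ ≤ _ := mul_le_mul_of_nonneg_left key2 d
    _ = _ := by ring

theorem stmt0 (α β γ x : ℝ) (hα : 0 < α) (hβ : α < β) (hγ : 1 ≤ γ) :
    x * ml3 α β γ x = ml3 α (β - α) γ x - ml3 α (β - α) (γ - 1) x := by
  have hb : 0 < β - α := by linarith
  have hg0 : γ ≠ 0 := by linarith
  have G : 0 < Real.Gamma γ := Real.Gamma_pos_of_pos (by linarith)
  have s1 := ml3_summable α (β - α) γ x hα hb (by linarith)
  have e2 (j : ℕ) : ((j + 1 : ℕ) : ℝ) * α + (β - α) = (j : ℝ) * α + β := by push_cast; ring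
  have gp (j : ℕ) : Real.Gamma ((j : ℝ) * α + β) ≠ 0 :=
    (Real.Gamma_pos_of_pos (by have : 0 ≤ (j : ℝ) * α := by positivity
                               linarith)).ne'
  have f0 (j : ℕ) : (j.factorial : ℝ) ≠ 0 := by exact_mod_cast j.factorial_ne_zero
  have j1 (j : ℕ) : (j : ℝ) + 1 ≠ 0 := by positivity
  have e1 (j : ℕ) : Real.Gamma (((j + 1 : ℕ) : ℝ) + γ) = (j + γ) * Real.Gamma (j + γ) := by
    rw [← Real.Gamma_add_one (by have : (0 : ℝ) ≤ j := Nat.cast_nonneg j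
                                 linarith)]; push_cast; ring_nf
  rcases eq_or_lt_of_le hγ with h | h
  · subst h
    simp only [ml3, sub_self, if_true, one_ne_zero, if_false, Real.Gamma_one, div_one, one_mul]
    rw [s1.tsum_eq_zero_add, ← tsum_mul_left]
    simp only [e1, e2, Nat.factorial_succ]
    simp only [Nat.cast_zero, zero_add, Real.Gamma_one, pow_zero, Nat.factorial_zero,
      Nat.cast_one, zero_mul, one_mul, add_sub_cancel_left]
    refine tsum_congr fun j => ?_
    have := gp j
    have := f0 j
    have := j1 j
    push_cast
    field_simp
    ring
  · have hg1 : γ - 1 ≠ 0 := by linarith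
    have s2 := ml3_summable α (β - α) (γ - 1) x hα hb (by linarith)
    have G1 : 0 < Real.Gamma (γ - 1) := Real.Gamma_pos_of_pos (by linarith)
    have GG : Real.Gamma γ = (γ - 1) * Real.Gamma (γ - 1) := by
      simpa using Real.Gamma_add_one hg1
    have e3 (j : ℕ) : Real.Gamma (((j + 1 : ℕ) : ℝ) + (γ - 1)) = Real.Gamma (j + γ) := by
      congr 1; push_cast; ring
    simp only [ml3, hg0, hg1, if_false]
    rw [s1.tsum_eq_zero_add, s2.tsum_eq_zero_add]
    have s1' := (summable_nat_add_iff 1).2 s1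
    have s2' := (summable_nat_add_iff 1).2 s2
    rw [mul_add, mul_add, ← tsum_mul_left, ← tsum_mul_left, ← tsum_mul_left, ← tsum_mul_left,
      add_sub_add_comm, ← (s1'.mul_left _).tsum_sub (s2'.mul_left _)]
    simp only [e1, e2, e3, Nat.factorial_succ]
    have z : ∀ g c : ℝ, g ≠ 0 → 1 / g * (g * 1 / c) = 1 / c := by
      intro g c hg; field_simp
    simp only [Nat.cast_zero, zero_add, pow_zero]
    rw [z _ _ G.ne', z _ _ G1.ne', sub_self, zero_add]
    refine tsum_congr fun j => ?_
    have := gp j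
    have := f0 j
    have := j1 j
    have := G1.ne'
    rw [GG]
    push_cast
    field_simp
    ring
end

section
/- For λ>0, 0<α≤1 and s>0, ∫_0^∞ e^{−st} λ² t^{2α} E_{α,2α+1}(−2λ t^α) dt = λ² s^{−α−1}/(s^α + 2λ); that is, the Laplace transform of the renewal function of N̂_α, given by m(t) = λ² t^{2α} E_{α,2α+1}(−2λ t^α), equals f̃(s)/(s(1 − f̃(s))) with f̃(s) = λ²/(s^α+λ)². -/
open MeasureTheory Set Filter Topology

lemma gamma_lower {b R : ℝ} (hb : 1 ≤ b) (hR : 0 < R) :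
    R ^ (b - 1) * Real.exp (-R) ≤ Real.Gamma b := by
  rw [Real.Gamma_eq_integral (by linarith), ← integral_exp_neg_Ioi, ← integral_const_mul]
  have hi := Real.GammaIntegral_convergent (s := b) (by linarith)
  calc _ ≤ ∫ x in Ioi R, Real.exp (-x) * x ^ (b - 1) := by
        apply setIntegral_mono_on
        · exact (integrableOn_exp_neg_Ioi R).const_mul _
        · exact hi.mono_set (Ioi_subset_Ioi hR.le)
        · exact measurableSet_Ioi
        · intro x hx
          rw [mul_comm]
          have : R ^ (b-1) ≤ x ^ (b-1) := Real.rpow_le_rpow hR.le (le_of_lt hx) (by linarith)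
          gcongr
    _ ≤ _ := by
        apply setIntegral_mono_set hi
        · filter_upwards [ae_restrict_mem measurableSet_Ioi] with x hx
          have : (0:ℝ) < x := hx
          simp only [Pi.zero_apply]; positivity
        · exact (Ioi_subset_Ioi hR.le).eventuallyLE

lemma real_int {a r : ℝ} (ha : 0 < a) (hr : 0 < r) :
    IntegrableOn (fun t : ℝ => t ^ (a - 1) * Real.exp (-(r * t))) (Ioi 0) := by
  have := integrableOn_rpow_mul_exp_neg_mul_rpow (p := 1) (s := a - 1) (b := r) (by linarith) one_pos hr
  simpa using this

lemma laplace_pow {a : ℝ} (ha : 0 < a) {z : ℂ} (hz : 0 < z.re) :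
    ∫ t in Ioi (0:ℝ), ((t ^ (a - 1) : ℝ) : ℂ) * Complex.exp (-(z * t))
      = z ^ (-(a:ℂ)) * (Real.Gamma a : ℂ) := by
  let μ : Measure ℝ := (volume.restrict (Ioi 0)).withDensity (fun t => ENNReal.ofReal (t ^ (a - 1)))
  have hmeas : Measurable (fun t : ℝ => ENNReal.ofReal (t ^ (a - 1))) := by fun_prop
  have hset : Iio 0 ⊆ ProbabilityTheory.integrableExpSet id μ := by
    intro r hr
    have hr : r < 0 := hr
    show Integrable _ μ
    rw [integrable_withDensity_iff_integrable_smul' hmeas (by simp)]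
    refine (real_int ha (neg_pos.2 hr)).congr ?_
    filter_upwards [ae_restrict_mem measurableSet_Ioi] with x hx
    have : (0:ℝ) < x := hx
    rw [ENNReal.toReal_ofReal (by positivity)]
    simp
  have hμ : ∀ w : ℂ, ProbabilityTheory.complexMGF id μ w
      = ∫ t in Ioi (0:ℝ), ((t ^ (a - 1) : ℝ) : ℂ) * Complex.exp (w * t) := by
    intro w
    rw [ProbabilityTheory.complexMGF, integral_withDensity_eq_integral_toReal_smul hmeas (by simp)]
    apply setIntegral_congr_fun measurableSet_Ioi
    intro x hx
    have : (0:ℝ) < x := hx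
    simp only
    rw [ENNReal.toReal_ofReal (by positivity)]
    simp
  have hA : AnalyticOnNhd ℂ (ProbabilityTheory.complexMGF id μ) {w | w.re < 0} := by
    intro w hw
    apply ProbabilityTheory.analyticAt_complexMGF
    exact interior_mono hset (by rw [interior_Iio]; exact hw)
  have hB : AnalyticOnNhd ℂ (fun w : ℂ => (-w) ^ (-(a:ℂ)) * (Real.Gamma a : ℂ)) {w | w.re < 0} := by
    apply DifferentiableOn.analyticOnNhd
    · intro w hw
      have hw : w.re < 0 := hw
      apply DifferentiableAt.differentiableWithinAt
      apply DifferentiableAt.mul_const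
      apply DifferentiableAt.cpow_const
      · fun_prop
      · left; simpa using hw
    · exact isOpen_lt Complex.continuous_re continuous_const
  have hr : ∀ r : ℝ, r < 0 → ProbabilityTheory.complexMGF id μ r = (-(r:ℂ)) ^ (-(a:ℂ)) * (Real.Gamma a : ℂ) := by
    intro r hr
    have h := Real.integral_rpow_mul_exp_neg_mul_Ioi ha (neg_pos.2 hr)
    rw [hμ]
    have h2 := congrArg (fun x : ℝ => (x:ℂ)) h
    beta_reduce at h2
    rw [← integral_complex_ofReal] at h2
    convert h2 using 1
    · congr 1; ext x; push_cast; simp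
    · push_cast
      rw [Complex.cpow_neg, one_div, ← Complex.ofReal_neg, ← Complex.ofReal_cpow (by linarith), ← Complex.ofReal_inv,
        Real.inv_rpow (by linarith)]
  have key := hA.eqOn_of_preconnected_of_frequently_eq hB (z₀ := -1)
    (convex_halfSpace_re_lt 0).isPreconnected (by simp) ?_
  · have := key (x := -z) (by simpa using hz)
    rw [hμ] at this
    simpa using this
  · have h1 : ∃ᶠ r : ℝ in 𝓝[≠] (-1), ProbabilityTheory.complexMGF id μ r = (-(r:ℂ)) ^ (-(a:ℂ)) * (Real.Gamma a : ℂ) := by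
      apply Eventually.frequently
      apply eventually_nhdsWithin_of_eventually_nhds
      filter_upwards [Iio_mem_nhds (show (-1:ℝ) < 0 by norm_num)] with r h
      exact hr r h
    have h2 : Tendsto (fun r : ℝ => (r:ℂ)) (𝓝[≠] (-1)) (𝓝[≠] (-1)) := by
      apply tendsto_nhdsWithin_of_tendsto_nhds_of_eventually_within
      · apply tendsto_nhdsWithin_of_tendsto_nhds
        have := Complex.continuous_ofReal.tendsto (-1)
        simpa using this
      · filter_upwards [self_mem_nhdsWithin] with r h h'
        apply h
        have h' : (r:ℂ) = -1 := h'
        have : r = -1 := by exact_mod_cast h'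
        exact this
    exact h2.frequently h1

noncomputable def mterm (α c : ℝ) (j : ℕ) (t : ℝ) : ℝ :=
  (-c) ^ j * (max t 0) ^ ((j:ℝ) * α + 2 * α) / Real.Gamma ((j:ℝ) * α + (2 * α + 1))

noncomputable def mfun (α c t : ℝ) : ℝ := ∑' j : ℕ, mterm α c j t

noncomputable def Ffun (α c : ℝ) (z : ℂ) : ℂ := z ^ (((-α - 1 : ℝ)) : ℂ) / (z ^ (α:ℂ) + c)

lemma mterm_bound {α c R : ℝ} (hα : 0 < α) (hc : 0 < c) (hR : 0 < R) (j : ℕ) (t : ℝ) :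
    ‖mterm α c j t‖ ≤ R ^ (-(2 * α)) * Real.exp (R * max t 0) * (c / R ^ α) ^ j := by
  have he : 0 < (j:ℝ) * α + 2 * α := by positivity
  rcases (le_max_right t 0).eq_or_lt with h | h
  · rw [mterm, ← h, Real.zero_rpow he.ne']
    simp only [mul_zero, zero_div, norm_zero]
    positivity
  · set u := max t 0
    have hG := gamma_lower (b := (j:ℝ) * α + (2 * α + 1)) (R := R * u) (by linarith) (by positivity)
    have hGpos : 0 < Real.Gamma ((j:ℝ) * α + (2 * α + 1)) := Real.Gamma_pos_of_pos (by positivity)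
    have e1 : (j:ℝ) * α + (2 * α + 1) - 1 = (j:ℝ) * α + 2 * α := by ring
    rw [e1, Real.mul_rpow hR.le h.le] at hG
    rw [mterm, norm_div, norm_mul, norm_pow, norm_neg, Real.norm_of_nonneg hc.le,
      Real.norm_of_nonneg hGpos.le, Real.norm_of_nonneg (by positivity), div_le_iff₀ hGpos]
    have e2 : R ^ ((j:ℝ) * α + 2 * α) = (R ^ α) ^ j * R ^ (2 * α) := by
      rw [Real.rpow_add hR, mul_comm (j:ℝ), Real.rpow_mul_natCast hR.le]
    have key : R ^ (-(2 * α)) * Real.exp (R * u) * (c / R ^ α) ^ j *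
        (R ^ ((j:ℝ) * α + 2 * α) * u ^ ((j:ℝ) * α + 2 * α) * Real.exp (-(R * u)))
        = c ^ j * u ^ ((j:ℝ) * α + 2 * α) := by
      rw [e2, Real.rpow_neg hR.le, Real.exp_neg, div_pow]
      have := (Real.exp_pos (R * u)).ne'
      have := (Real.rpow_pos_of_pos hR α).ne'
      have := (Real.rpow_pos_of_pos hR (2 * α)).ne'
      field_simp
    rw [← key]
    gcongr

lemma exists_R {α c : ℝ} (hα : 0 < α) (hc : 0 < c) : ∃ R : ℝ, 0 < R ∧ R ^ α = 2 * c := by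
  refine ⟨(2 * c) ^ (1 / α), by positivity, ?_⟩
  rw [← Real.rpow_mul (by positivity), one_div, inv_mul_cancel₀ hα.ne', Real.rpow_one]

lemma mterm_cont {α c : ℝ} (hα : 0 < α) (j : ℕ) : Continuous (mterm α c j) := by
  unfold mterm
  have he : 0 ≤ (j:ℝ) * α + 2 * α := by positivity
  have : Continuous fun t : ℝ => (max t 0) ^ ((j:ℝ) * α + 2 * α) :=
    (continuous_id.max continuous_const).rpow_const (fun _ => Or.inr he)
  fun_prop

lemma sum_half (K : ℝ) {c R α : ℝ} (hc : 0 < c) (h : R ^ α = 2 * c) :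
    HasSum (fun j : ℕ => K * (c / R ^ α) ^ j) (K * 2) := by
  have : c / R ^ α = 1 / 2 := by rw [h]; field_simp
  rw [this]
  exact hasSum_geometric_two.mul_left K

lemma mfun_cont {α c : ℝ} (hα : 0 < α) (hc : 0 < c) : Continuous (mfun α c) := by
  obtain ⟨R, hR, hRc⟩ := exists_R hα hc
  rw [continuous_iff_continuousAt]
  intro t
  have h : ContinuousOn (mfun α c) (Iio (t + 1)) := by
    apply continuousOn_tsum (u := fun j : ℕ => R ^ (-(2 * α)) * Real.exp (R * max (t + 1) 0) * (c / R ^ α) ^ j)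
    · intro j; exact (mterm_cont hα j).continuousOn
    · exact (sum_half _ hc hRc).summable
    · intro j x hx
      refine (mterm_bound hα hc hR j x).trans ?_
      have : x ≤ t + 1 := le_of_lt hx
      gcongr
  exact h.continuousAt (Iio_mem_nhds (by linarith))

lemma mfun_bound {α c R : ℝ} (hα : 0 < α) (hc : 0 < c) (hR : 0 < R) (hRc : R ^ α = 2 * c) (t : ℝ) :
    ‖mfun α c t‖ ≤ R ^ (-(2 * α)) * Real.exp (R * max t 0) * 2 :=
  tsum_of_norm_bounded (sum_half _ hc hRc) (fun j => mterm_bound hα hc hR j t)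

lemma mfun_neg {α c t : ℝ} (hα : 0 < α) (ht : t ≤ 0) : mfun α c t = 0 := by
  unfold mfun mterm
  convert tsum_zero with j
  have he : 0 < (j:ℝ) * α + 2 * α := by positivity
  rw [max_eq_right ht, Real.zero_rpow he.ne']
  simp

lemma lower_bound {α c : ℝ} (hα : 0 < α) (hα1 : α ≤ 1) (_hc : 0 < c) {z : ℂ} (hz : 0 < z.re) :
    c ≤ ‖z ^ (α:ℂ) + c‖ := by
  refine le_trans ?_ ((le_abs_self _).trans (Complex.abs_re_le_norm _))
  have hz0 : z ≠ 0 := by rintro rfl; simp at hz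
  have harg := Complex.abs_arg_le_pi_div_two_iff.2 hz.le
  have : 0 ≤ (z ^ (α:ℂ)).re := by
    rw [Complex.cpow_def_of_ne_zero hz0, Complex.exp_re]
    refine mul_nonneg (Real.exp_pos _).le (Real.cos_nonneg_of_mem_Icc ?_)
    have e : (Complex.log z * (α:ℂ)).im = Complex.arg z * α := by simp [Complex.log_im]
    rw [e, mem_Icc, ← abs_le, abs_mul, abs_of_pos hα]
    nlinarith [abs_nonneg (Complex.arg z)]
  simp; exact this

lemma Ffun_bound {α c : ℝ} (hα : 0 < α) (hα1 : α ≤ 1) (hc : 0 < c) {z : ℂ} (hz : 0 < z.re) :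
    ‖Ffun α c z‖ ≤ ‖z‖ ^ (-α - 1) / c := by
  rw [Ffun, norm_div, Complex.norm_cpow_real]
  have := lower_bound hα hα1 hc hz
  gcongr

lemma Ffun_diff {α c : ℝ} (hα : 0 < α) (hα1 : α ≤ 1) (hc : 0 < c) {z : ℂ} (hz : 0 < z.re) :
    DifferentiableAt ℂ (Ffun α c) z := by
  unfold Ffun
  have h0 : z ^ (α:ℂ) + c ≠ 0 := by
    have := lower_bound hα hα1 hc hz
    rw [← norm_pos_iff]; linarith
  have hs : z ∈ Complex.slitPlane := Or.inl hz
  refine DifferentiableAt.div ?_ ?_ h0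
  · exact differentiableAt_id.cpow_const hs
  · exact (differentiableAt_id.cpow_const hs).add_const _

/-- Laplace transform for large real part. -/
lemma laplace_large {α c R : ℝ} (hα : 0 < α) (hα1 : α ≤ 1) (hc : 0 < c) (hR : 0 < R)
    (hRc : R ^ α = 2 * c) {z : ℂ} (hz : R < z.re) :
    ∫ t in Ioi (0:ℝ), (mfun α c t : ℂ) * Complex.exp (-(z * t)) = Ffun α c z := by
  have hz1 : 0 < z.re := hR.trans hz
  have hz0 : z ≠ 0 := by rintro rfl; simp at hz1
  have hRz : R < ‖z‖ := hz.trans_le ((le_abs_self _).trans (Complex.abs_re_le_norm _))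
  have hei : IntegrableOn (fun t : ℝ => Real.exp (-(z.re - R) * t)) (Ioi 0) :=
    integrableOn_exp_mul_Ioi (by linarith) 0
  have hb : ∀ j : ℕ, ∀ t ∈ Ioi (0:ℝ), ‖(mterm α c j t : ℂ) * Complex.exp (-(z * t))‖ ≤
      R ^ (-(2 * α)) * (c / R ^ α) ^ j * Real.exp (-(z.re - R) * t) := by
    intro j t ht
    have ht : (0:ℝ) < t := ht
    have := mterm_bound hα hc hR j t
    rw [norm_mul, Complex.norm_real, Complex.norm_exp]
    have e : (-(z * (t:ℂ))).re = -(z.re * t) := by simp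
    rw [e]
    calc _ ≤ (R ^ (-(2 * α)) * Real.exp (R * max t 0) * (c / R ^ α) ^ j) * Real.exp (-(z.re * t)) := by gcongr
      _ = _ := by
        rw [max_eq_left ht.le]
        have : Real.exp (-(z.re - R) * t) = Real.exp (R * t) * Real.exp (-(z.re * t)) := by
          rw [← Real.exp_add]; ring_nf
        rw [this]; ring
  have hint : ∀ j : ℕ, IntegrableOn (fun t : ℝ => (mterm α c j t : ℂ) * Complex.exp (-(z * t))) (Ioi 0) := by
    intro j
    refine Integrable.mono' (hei.const_mul (R ^ (-(2 * α)) * (c / R ^ α) ^ j)) ?_ ?_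
    · have := mterm_cont (c := c) hα j
      exact Continuous.aestronglyMeasurable (by fun_prop)
    · filter_upwards [ae_restrict_mem measurableSet_Ioi] with t ht using hb j t ht
  have hsum := hasSum_integral_of_summable_integral_norm hint (by
    refine Summable.of_nonneg_of_le (fun j => integral_nonneg fun _ => norm_nonneg _) (fun j =>
      setIntegral_mono_on (hint j).norm (hei.const_mul (R ^ (-(2 * α)) * (c / R ^ α) ^ j)) measurableSet_Ioi (hb j)) ?_
    simp_rw [integral_const_mul, mul_right_comm _ _ (∫ t in Ioi (0:ℝ), Real.exp (-(z.re - R) * t))]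
    exact (sum_half _ hc hRc).summable)
  have hlhs : ∫ t in Ioi (0:ℝ), (mfun α c t : ℂ) * Complex.exp (-(z * t)) =
      ∫ t in Ioi (0:ℝ), ∑' j : ℕ, (mterm α c j t : ℂ) * Complex.exp (-(z * t)) := by
    congr 1; ext t
    rw [tsum_mul_right, mfun, Complex.ofReal_tsum]
  rw [hlhs]
  refine hsum.unique ?_
  have hterm : ∀ j : ℕ, ∫ t in Ioi (0:ℝ), (mterm α c j t : ℂ) * Complex.exp (-(z * t))
      = z ^ (-((2 * α + 1 : ℝ) : ℂ)) * (-c * z ^ (-(α:ℂ))) ^ j := by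
    intro j
    have ha : 0 < (j:ℝ) * α + (2 * α + 1) := by positivity
    have hG : (Real.Gamma ((j:ℝ) * α + (2 * α + 1)) : ℂ) ≠ 0 := by
      exact_mod_cast (Real.Gamma_pos_of_pos ha).ne'
    have h := laplace_pow ha hz1
    calc _ = ∫ t in Ioi (0:ℝ), ((-c : ℂ) ^ j / (Real.Gamma ((j:ℝ) * α + (2 * α + 1)) : ℂ)) *
          (((t ^ ((j:ℝ) * α + (2 * α + 1) - 1) : ℝ) : ℂ) * Complex.exp (-(z * t))) := by
          apply setIntegral_congr_fun measurableSet_Ioi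
          intro t ht
          have ht : (0:ℝ) < t := ht
          simp only [mterm]
          rw [max_eq_left ht.le, show (j:ℝ) * α + (2 * α + 1) - 1 = (j:ℝ) * α + 2 * α by ring]
          push_cast
          ring
      _ = _ := by
          rw [integral_const_mul, h]
          have : z ^ (-(((j:ℝ) * α + (2 * α + 1) : ℝ) : ℂ)) = z ^ (-((2 * α + 1 : ℝ) : ℂ)) * (z ^ (-(α:ℂ))) ^ j := by
            rw [← Complex.cpow_nat_mul, ← Complex.cpow_add _ _ hz0]
            congr 1; push_cast; ring
          rw [this, mul_pow]
          generalize (Real.Gamma ((j:ℝ) * α + (2 * α + 1)) : ℂ) = G at hG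
          generalize z ^ (-((2 * α + 1 : ℝ) : ℂ)) = Z
          field_simp
  simp_rw [hterm]
  have hq : ‖(-c * z ^ (-(α:ℂ)) : ℂ)‖ < 1 := by
    have : z ^ (-(α:ℂ)) = z ^ ((-α : ℝ) : ℂ) := by push_cast; rfl
    rw [this, norm_mul, Complex.norm_cpow_real, norm_neg, Complex.norm_real, Real.norm_of_nonneg hc.le,
      Real.rpow_neg (norm_nonneg _)]
    have h3 : R ^ α < ‖z‖ ^ α := Real.rpow_lt_rpow hR.le hRz hα
    rw [← div_eq_mul_inv, div_lt_one (by linarith)]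
    linarith
  have := (hasSum_geometric_of_norm_lt_one hq).mul_left (z ^ (-((2 * α + 1 : ℝ) : ℂ)))
  suffices hF : Ffun α c z = z ^ (-((2 * α + 1 : ℝ) : ℂ)) * (1 - -(c:ℂ) * z ^ (-(α:ℂ)))⁻¹ by
    rw [hF]; exact this
  have h0 : z ^ (α:ℂ) + c ≠ 0 := by
    have := lower_bound hα hα1 hc hz1
    rw [← norm_pos_iff]; linarith
  have hza : z ^ (α:ℂ) ≠ 0 := by simp [Complex.cpow_eq_zero_iff, hz0]
  have e : z ^ (((-α - 1 : ℝ)) : ℂ) = z ^ (-((2 * α + 1 : ℝ) : ℂ)) * z ^ (α:ℂ) := by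
    rw [← Complex.cpow_add _ _ hz0]; congr 1; push_cast; ring
  rw [Ffun, e, Complex.cpow_neg z α]
  have : (1 - -(c:ℂ) * (z ^ (α:ℂ))⁻¹) = (z ^ (α:ℂ) + c) / z ^ (α:ℂ) := by field_simp; ring
  rw [this]
  field_simp

lemma Fl_cont {α c σ : ℝ} (hα : 0 < α) (hα1 : α ≤ 1) (hc : 0 < c) (hσ : 0 < σ) :
    Continuous (fun y : ℝ => Ffun α c (σ + y * Complex.I)) := by
  rw [continuous_iff_continuousAt]
  intro y
  have h := (Ffun_diff hα hα1 hc (z := σ + y * Complex.I) (by simpa using hσ)).continuousAt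
  exact ContinuousAt.comp (f := fun y : ℝ => (σ + y * Complex.I : ℂ)) h (by fun_prop)

lemma norm_lower {σ y : ℝ} (hσ : 0 < σ) :
    min σ 1 / 2 * (1 + ‖y‖) ≤ ‖(σ + y * Complex.I : ℂ)‖ := by
  have h1 : σ ≤ ‖(σ + y * Complex.I : ℂ)‖ := by
    have := Complex.abs_re_le_norm (σ + y * Complex.I : ℂ)
    simp at this; exact (le_abs_self _).trans this
  have h2 : ‖y‖ ≤ ‖(σ + y * Complex.I : ℂ)‖ := by
    have := Complex.abs_im_le_norm (σ + y * Complex.I : ℂ)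
    simp at this; exact this
  have h3 := min_le_left σ 1
  have h4 := min_le_right σ 1
  have h5 : min σ 1 * ‖y‖ ≤ 1 * ‖y‖ := by gcongr
  linarith

lemma Fl_int {α c σ : ℝ} (hα : 0 < α) (hα1 : α ≤ 1) (hc : 0 < c) (hσ : 0 < σ) :
    Integrable (fun y : ℝ => Ffun α c (σ + y * Complex.I)) := by
  have h := (integrable_one_add_norm (E := ℝ) (μ := volume) (r := α + 1) (by simpa using hα)).const_mul
    ((min σ 1 / 2) ^ (-α - 1) / c)
  refine h.mono' (Fl_cont hα hα1 hc hσ).aestronglyMeasurable (ae_of_all _ fun y => ?_)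
  refine (Ffun_bound hα hα1 hc (by simpa using hσ)).trans ?_
  have hm : 0 < min σ 1 / 2 := by positivity
  have := Real.rpow_le_rpow_of_nonpos (z := -α - 1) (by positivity) (norm_lower (y := y) hσ) (by linarith)
  rw [Real.mul_rpow hm.le (by positivity), show (-α - 1 : ℝ) = -(α + 1) by ring] at this
  rw [show (-α - 1 : ℝ) = -(α + 1) by ring, div_mul_eq_mul_div]
  gcongr

lemma fexp_norm (t : ℝ) (z : ℂ) : ‖Complex.exp (z * t)‖ = Real.exp (z.re * t) := by
  rw [Complex.norm_exp]; simp

lemma Vint {α c σ : ℝ} (hα : 0 < α) (hα1 : α ≤ 1) (hc : 0 < c) (hσ : 0 < σ) (t : ℝ) :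
    Integrable (fun y : ℝ => Ffun α c (σ + y * Complex.I) * Complex.exp ((σ + y * Complex.I) * t)) := by
  refine (Fl_int hα hα1 hc hσ).mul_bdd (c := Real.exp (σ * t)) ?_ ?_
  · exact Continuous.aestronglyMeasurable (by fun_prop)
  · refine ae_of_all _ fun y => ?_
    rw [fexp_norm]; simp

lemma horiz {α c : ℝ} (hα : 0 < α) (hα1 : α ≤ 1) (hc : 0 < c) {σ₁ σ₂ : ℝ} (h1 : 0 < σ₁)
    (h12 : σ₁ ≤ σ₂) (t : ℝ) {T : ℝ → ℝ} (hT : Tendsto (fun x => |T x|) atTop atTop) :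
    Tendsto (fun x : ℝ => ∫ u in σ₁..σ₂, Ffun α c (u + T x * Complex.I) * Complex.exp ((u + T x * Complex.I) * t))
      atTop (𝓝 0) := by
  have hlim : Tendsto (fun x : ℝ => |T x| ^ (-(α + 1)) / c * Real.exp (σ₂ * |t|) * |σ₂ - σ₁|) atTop (𝓝 0) := by
    have := (((tendsto_rpow_neg_atTop (y := α + 1) (by linarith)).comp hT).div_const c).mul_const (Real.exp (σ₂ * |t|))
    have := this.mul_const |σ₂ - σ₁|
    simpa using this
  refine squeeze_zero_norm' ?_ hlim
  filter_upwards [hT.eventually_gt_atTop 0] with x hx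
  apply intervalIntegral.norm_integral_le_of_norm_le_const
  intro u hu
  rw [uIoc_of_le h12] at hu
  have hu0 : 0 < u := h1.trans hu.1
  rw [norm_mul, fexp_norm]
  have hb := Ffun_bound hα hα1 hc (z := u + T x * Complex.I) (by simpa using hu0)
  have h2 : |T x| ≤ ‖(u + T x * Complex.I : ℂ)‖ := by
    have := Complex.abs_im_le_norm (u + T x * Complex.I : ℂ)
    simp at this; exact this
  have h3 := Real.rpow_le_rpow_of_nonpos (z := -α - 1) hx h2 (by linarith)
  rw [show (-(α + 1) : ℝ) = -α - 1 by ring]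
  have h4 : ((u + T x * Complex.I : ℂ).re * t) ≤ σ₂ * |t| := by
    simp
    calc u * t ≤ u * |t| := by gcongr; exact le_abs_self t
      _ ≤ _ := by gcongr; exact hu.2
  calc _ ≤ (‖(u + T x * Complex.I : ℂ)‖ ^ (-α - 1) / c) * Real.exp ((u + T x * Complex.I : ℂ).re * t) := by gcongr
    _ ≤ _ := by gcongr

lemma contour {α c : ℝ} (hα : 0 < α) (hα1 : α ≤ 1) (hc : 0 < c) {σ₁ σ₂ : ℝ} (h1 : 0 < σ₁)
    (h12 : σ₁ ≤ σ₂) (t : ℝ) :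
    ∫ y : ℝ, Ffun α c (σ₁ + y * Complex.I) * Complex.exp ((σ₁ + y * Complex.I) * t) =
    ∫ y : ℝ, Ffun α c (σ₂ + y * Complex.I) * Complex.exp ((σ₂ + y * Complex.I) * t) := by
  have hV1 := intervalIntegral_tendsto_integral (Vint hα hα1 hc h1 t) tendsto_neg_atTop_atBot tendsto_id
  have hV2 := intervalIntegral_tendsto_integral (Vint hα hα1 hc (h1.trans_le h12) t) tendsto_neg_atTop_atBot tendsto_id
  have hH1 := horiz hα hα1 hc h1 h12 t (T := fun x => -x) (by simpa using tendsto_abs_atTop_atTop)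
  have hH2 := horiz hα hα1 hc h1 h12 t (T := fun x => x) tendsto_abs_atTop_atTop
  have hlim := ((hH1.sub hH2).add (hV2.const_smul Complex.I)).sub (hV1.const_smul Complex.I)
  have hz : ∀ T : ℝ, _ := fun T : ℝ => Complex.integral_boundary_rect_eq_zero_of_differentiableOn
    (fun z => Ffun α c z * Complex.exp (z * t)) (σ₁ + ((-T : ℝ):ℂ) * Complex.I) (σ₂ + (T:ℂ) * Complex.I) (by
      intro z hz
      apply DifferentiableAt.differentiableWithinAt
      have hre : 0 < z.re := by
        have := (Complex.mem_reProdIm.1 hz).1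
        simp only [Complex.add_re, Complex.ofReal_re, Complex.mul_re, Complex.I_re, Complex.I_im, Complex.ofReal_im] at this
        simp only [mul_zero, zero_mul, sub_zero, add_zero] at this
        rw [uIcc_of_le h12] at this
        exact h1.trans_le this.1
      have := Ffun_diff hα hα1 hc hre
      fun_prop)
  have h0 := tendsto_nhds_unique (hlim.congr (f₂ := fun _ => (0:ℂ)) (fun T => by
    rw [← hz T]; simp)) tendsto_const_nhds
  simp only [sub_zero, zero_add, smul_eq_mul, ← mul_sub] at h0
  rw [mul_eq_zero, sub_eq_zero] at h0
  rcases h0 with h0 | h0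
  · simp at h0
  · exact h0.symm

open FourierTransform

noncomputable def hfun (α c σ t : ℝ) : ℂ := ((mfun α c t * Real.exp (-(σ * t)) : ℝ) : ℂ)

noncomputable def Fs (α c σ ω : ℝ) : ℂ := Ffun α c (σ + ((2 * Real.pi * ω : ℝ) : ℂ) * Complex.I)

lemma Fs_cont {α c σ : ℝ} (hα : 0 < α) (hα1 : α ≤ 1) (hc : 0 < c) (hσ : 0 < σ) :
    Continuous (Fs α c σ) :=
  (Fl_cont hα hα1 hc hσ).comp (f := fun ω : ℝ => 2 * Real.pi * ω) (by fun_prop)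

lemma Fs_int {α c σ : ℝ} (hα : 0 < α) (hα1 : α ≤ 1) (hc : 0 < c) (hσ : 0 < σ) :
    Integrable (Fs α c σ) :=
  (Fl_int hα hα1 hc hσ).comp_mul_left' (R := 2 * Real.pi) (by positivity)

lemma inv_Fs (α c σ t : ℝ) : 𝓕⁻ (Fs α c σ) t = Complex.exp (-(σ * t)) * ((2 * Real.pi)⁻¹ : ℝ) *
    ∫ y : ℝ, Ffun α c (σ + y * Complex.I) * Complex.exp ((σ + y * Complex.I) * t) := by
  rw [Real.fourierInv_eq']
  have := Measure.integral_comp_mul_left (fun y : ℝ => Ffun α c (σ + y * Complex.I) * Complex.exp ((σ + y * Complex.I) * t)) (2 * Real.pi)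
  rw [abs_of_pos (by positivity), Complex.real_smul] at this
  rw [mul_assoc, ← this, ← integral_const_mul]
  congr 1; ext ω
  simp only [Fs, smul_eq_mul]
  have : Complex.exp (((2 * Real.pi * inner ℝ ω t : ℝ) : ℂ) * Complex.I) = Complex.exp (-(σ * t)) *
      Complex.exp ((σ + ((2 * Real.pi * ω : ℝ):ℂ) * Complex.I) * t) := by
    rw [← Complex.exp_add]
    congr 1
    simp
    ring
  rw [this]; ring

lemma hfun_cont {α c : ℝ} (hα : 0 < α) (hc : 0 < c) (σ : ℝ) : Continuous (hfun α c σ) := by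
  have := mfun_cont hα hc
  unfold hfun
  fun_prop

lemma hfun_int_of {α c σ K τ : ℝ} (hα : 0 < α) (hc : 0 < c) (hτ : τ < σ)
    (hb : ∀ t, 0 < t → ‖mfun α c t‖ ≤ K * Real.exp (τ * t)) : Integrable (hfun α c σ) := by
  have : IntegrableOn (hfun α c σ) (Ioi 0) := by
    refine Integrable.mono' ((integrableOn_exp_mul_Ioi (a := τ - σ) (by linarith) 0).const_mul K)
      (hfun_cont hα hc σ).aestronglyMeasurable ?_
    filter_upwards [ae_restrict_mem measurableSet_Ioi] with t ht
    rw [hfun, Complex.norm_real, norm_mul, Real.norm_of_nonneg (Real.exp_pos _).le]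
    calc _ ≤ K * Real.exp (τ * t) * Real.exp (-(σ * t)) := by gcongr; exact hb t ht
      _ = _ := by rw [mul_assoc, ← Real.exp_add]; ring_nf
  refine this.integrable_of_forall_notMem_eq_zero ?_
  intro t ht
  rw [hfun, mfun_neg hα (not_lt.1 ht)]; simp

lemma fourier_hfun {α c σ : ℝ} (hα : 0 < α) (w : ℝ) : 𝓕 (hfun α c σ) w =
    ∫ t in Ioi (0:ℝ), (mfun α c t : ℂ) * Complex.exp (-((σ + ((2 * Real.pi * w : ℝ) : ℂ) * Complex.I) * t)) := by
  rw [Real.fourier_eq', ← setIntegral_eq_integral_of_forall_compl_eq_zero (s := Ioi 0)]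
  · congr 1; ext t
    simp only [hfun, smul_eq_mul]
    push_cast
    rw [mul_comm, mul_assoc, ← Complex.exp_add]
    congr 2
    simp
    ring
  · intro t ht
    rw [hfun, mfun_neg hα (not_lt.1 ht)]; simp

lemma hfun_eq {α c σ : ℝ} (hα : 0 < α) (hα1 : α ≤ 1) (hc : 0 < c) (hσ : 0 < σ) :
    𝓕⁻ (Fs α c σ) = hfun α c σ := by
  obtain ⟨R, hR, hRc⟩ := exists_R hα hc
  set S := max σ (R + 1)
  have hS : R < S := lt_of_lt_of_le (by linarith) (le_max_right _ _)
  have hF : 𝓕 (hfun α c S) = Fs α c S := by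
    ext w
    rw [fourier_hfun hα, laplace_large hα hα1 hc hR hRc (by simpa using hS), Fs]
  have hi : Integrable (hfun α c S) := by
    refine hfun_int_of hα hc hS (K := R ^ (-(2 * α)) * 2) ?_
    intro t ht
    have := mfun_bound hα hc hR hRc t
    rw [max_eq_left ht.le] at this
    linarith
  have hinv := (hfun_cont hα hc S).fourierInv_fourier_eq hi (by rw [hF]; exact Fs_int hα hα1 hc (hR.trans hS))
  rw [hF] at hinv
  ext t
  have h2 := congrFun hinv t
  rw [inv_Fs, ← contour hα hα1 hc hσ (le_max_left _ _) t] at h2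
  rw [inv_Fs]
  have e : Complex.exp (-(σ * t)) = Complex.exp ((S - σ) * t) * Complex.exp (-(S * t)) := by
    rw [← Complex.exp_add]; ring_nf
  rw [e, mul_assoc, mul_assoc, ← mul_assoc (Complex.exp (-(S * t))), h2, hfun, hfun]
  push_cast
  rw [mul_left_comm, ← Complex.exp_add]
  ring_nf

lemma hfun_int {α c σ : ℝ} (hα : 0 < α) (hα1 : α ≤ 1) (hc : 0 < c) (hσ : 0 < σ) :
    Integrable (hfun α c σ) := by
  have hσ2 : 0 < σ / 2 := by positivity
  refine hfun_int_of hα hc (τ := σ / 2) (by linarith) (K := ∫ ω, ‖Fs α c (σ / 2) ω‖) ?_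
  intro t ht
  have h := congrFun (hfun_eq hα hα1 hc hσ2) t
  have h2 : ‖hfun α c (σ / 2) t‖ ≤ ∫ ω, ‖Fs α c (σ / 2) ω‖ := by
    rw [← h, Real.fourierInv_eq']
    refine (norm_integral_le_integral_norm _).trans (le_of_eq ?_)
    congr 1; ext ω
    rw [norm_smul, Complex.norm_exp_ofReal_mul_I, one_mul]
  rw [hfun, Complex.norm_real, norm_mul, Real.norm_of_nonneg (Real.exp_pos _).le, Real.exp_neg,
    ← div_eq_mul_inv, div_le_iff₀ (Real.exp_pos _)] at h2
  exact h2

lemma laplace_all {α c σ : ℝ} (hα : 0 < α) (hα1 : α ≤ 1) (hc : 0 < c) (hσ : 0 < σ) :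
    ∫ t in Ioi (0:ℝ), mfun α c t * Real.exp (-(σ * t)) = σ ^ (-α - 1) / (σ ^ α + c) := by
  have hH := hfun_eq hα hα1 hc hσ
  have hi := hfun_int hα hα1 hc hσ
  -- F(-t) transform of inverse
  have hFi : Integrable (𝓕 (Fs α c σ)) := by
    have : 𝓕 (Fs α c σ) = fun t => hfun α c σ (-t) := by
      ext t
      rw [← hH, Real.fourierInv_eq_fourier_neg, neg_neg]
    rw [this]
    exact hi.comp_neg
  have h := congrFun ((Fs_cont hα hα1 hc hσ).fourier_fourierInv_eq (Fs_int hα hα1 hc hσ) hFi) 0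
  rw [hH, fourier_hfun hα] at h
  simp only [Fs, Ffun] at h
  have h2 : ((∫ t in Ioi (0:ℝ), mfun α c t * Real.exp (-(σ * t)) : ℝ) : ℂ) = ((σ ^ (-α - 1) / (σ ^ α + c) : ℝ) : ℂ) := by
    rw [← integral_complex_ofReal]
    push_cast [Complex.ofReal_cpow hσ.le]
    simpa using h
  exact_mod_cast h2

theorem stmt19 (α l s : ℝ) (hα0 : 0 < α) (hα1 : α ≤ 1) (hl : 0 < l) (hs : 0 < s) :
    (∫ t in Set.Ioi (0 : ℝ),
        Real.exp (-(s * t)) * (l ^ 2 * t ^ (2 * α) * ml3 α (2 * α + 1) 1 (-(2 * l * t ^ α))))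
      = l ^ 2 * s ^ (-α - 1) / (s ^ α + 2 * l)
    ∧ l ^ 2 * s ^ (-α - 1) / (s ^ α + 2 * l)
      = (l ^ 2 / (s ^ α + l) ^ 2) / (s * (1 - l ^ 2 / (s ^ α + l) ^ 2)) := by
  constructor
  · rw [mul_div_assoc, ← laplace_all hα0 hα1 (by positivity : 0 < 2 * l) hs, ← integral_const_mul]
    apply setIntegral_congr_fun measurableSet_Ioi
    intro t ht
    have ht : (0:ℝ) < t := ht
    have key : t ^ (2 * α) * ml3 α (2 * α + 1) 1 (-(2 * l * t ^ α)) = mfun α (2 * l) t := by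
      rw [ml3, if_neg one_ne_zero, Real.Gamma_one, div_one, one_mul, mfun, ← tsum_mul_left]
      congr 1; ext j
      rw [mterm, Real.Gamma_nat_eq_factorial, max_eq_left ht.le, Real.rpow_add ht, mul_comm (j:ℝ) α,
        Real.rpow_mul_natCast ht.le, ← neg_mul, mul_pow]
      have : (j.factorial : ℝ) ≠ 0 := by positivity
      rw [mul_div_mul_left _ _ this]
      ring
    simp only
    rw [mul_assoc (l ^ 2), key]; ring
  · have hx : 0 < s ^ α := by positivity
    rw [Real.rpow_sub hs, Real.rpow_neg hs.le, Real.rpow_one]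
    generalize s ^ α = x at hx
    have h1 : x + l ≠ 0 := by positivity
    have h2 : x + 2 * l ≠ 0 := by positivity
    have e : 1 - l ^ 2 / (x + l) ^ 2 = x * (x + 2 * l) / (x + l) ^ 2 := by
      field_simp; ring
    rw [e]
    field_simp
end
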